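/- Every morphism of large Lawvere theories between bounded large Lawvere theories preserves the approximation preorder: if F : L → L' is a morphism of large Lawvere theories with L, L' bounded and f ⊑ g in L, then F f ⊑ F g in L'. -/

import Mathlib

/-- A large Lawvere theory: a locally small category whose objects are the (small) sets/types,
with small products, together with a strict product-preserving identity-on-objects functor
`Set^op → L`.  Products of a small family `m : k → Type` are given strictly on the
set-theoretic coproduct `Σ i, m i`, with projections `[Sigma.mk i]` induced by the
indexing functor `ofFun`. -/
structure LawvereTheory : Type 1 where
  Hom : Type → Type → Type
  id : (n : Type) → Hom n n
  comp : {n m k : Type} → Hom m k → Hom n m → Hom n k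
  comp_id : ∀ {n m : Type} (f : Hom n m), comp f (id n) = f
  id_comp : ∀ {n m : Type} (f : Hom n m), comp (id m) f = f
  comp_assoc : ∀ {n m k l : Type} (f : Hom k l) (g : Hom m k) (h : Hom n m),
    comp (comp f g) h = comp f (comp g h)
  /-- the indexing functor `I : Set^op → L`; for a set-map `e : m → n` we write `[e] : n → m`. -/
  ofFun : {n m : Type} → (m → n) → Hom n m
  ofFun_id : ∀ (n : Type), ofFun (fun x : n => x) = id n
  ofFun_comp : ∀ {n m k : Type} (e : k → m) (e' : m → n),
    ofFun (fun x => e' (e x)) = comp (ofFun e) (ofFun e')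
  /-- tupling into the small product `Σ i, m i` of the family `m`. -/
  tuple : {n k : Type} → {m : k → Type} → ((i : k) → Hom n (m i)) → Hom n ((i : k) × m i)
  tuple_proj : ∀ {n k : Type} {m : k → Type} (f : (i : k) → Hom n (m i)) (i : k),
    comp (ofFun (fun x : m i => Sigma.mk i x)) (tuple f) = f i
  tuple_ext : ∀ {n k : Type} {m : k → Type} (g h : Hom n ((i : k) × m i)),
    (∀ i : k, comp (ofFun (fun x : m i => Sigma.mk i x)) g
      = comp (ofFun (fun x : m i => Sigma.mk i x)) h) → g = h

namespace LawvereTheory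

variable (L : LawvereTheory)

/-- `[κ_i] : m → 1`, the `i`-th product projection of `m` viewed as the `m`-fold power of `1`. -/
def proj {m : Type} (i : m) : L.Hom m PUnit :=
  L.ofFun (fun _ => i)

/-- tupling into the power `n × m` (`m`-fold power of `n`, carrier `n × m`). -/
def tupleR {p n m : Type} (f : m → L.Hom p n) : L.Hom p (n × m) :=
  L.comp (L.ofFun (fun x : n × m => (⟨x.2, x.1⟩ : Σ _ : m, n))) (L.tuple f)

/-- tupling into the power `m × n` (`m`-fold power of `n`, carrier `m × n`). -/
def tupleL {p n m : Type} (f : m → L.Hom p n) : L.Hom p (m × n) :=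
  L.comp (L.ofFun (fun x : m × n => (⟨x.1, x.2⟩ : Σ _ : m, n))) (L.tuple f)

/-- `f ⊗ m : n × m → k × m`, the `m`-fold power of `f : n → k`. -/
def tensorR {n k : Type} (f : L.Hom n k) (m : Type) : L.Hom (n × m) (k × m) :=
  L.tupleR (fun j => L.comp f (L.ofFun (fun x : n => (x, j))))

/-- `m ⊗ f : m × n → m × k`, the `m`-fold power of `f : n → k`. -/
def tensorL (m : Type) {n k : Type} (f : L.Hom n k) : L.Hom (m × n) (m × k) :=
  L.tupleL (fun j => L.comp f (L.ofFun (fun x : n => (j, x))))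

/-- the constants of `L`: the elements of `L(0,1)`. -/
def consts : Type := L.Hom PEmpty PUnit

/-- a constant, viewed as a morphism `n → 1` (composition with `[♯] : n → 0`). -/
def toConst {n : Type} (f : L.Hom PEmpty PUnit) : L.Hom n PUnit :=
  L.comp f (L.ofFun (fun x : PEmpty => x.elim))

/-- `c^n_L : n → n + c_L`, the morphism `[id] × ∏_{f ∈ c_L} f`. -/
def constTuple (n : Type) : L.Hom n (n ⊕ L.consts) :=
  L.comp (L.ofFun (fun i : n ⊕ L.consts => (⟨i, PUnit.unit⟩ : Σ _ : n ⊕ L.consts, PUnit)))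
    (L.tuple (fun i : n ⊕ L.consts =>
      match i with
      | Sum.inl i₀ => L.proj i₀
      | Sum.inr f => L.toConst f))

/-- A large Lawvere theory `L` is uniform if every `L`-morphism `f : n → m` has a
generic morphism: some `f̂ : k → 1` and a set-function `u : k × m → n + c_L` with
`f = (f̂ ⊗ m) ∘ [u] ∘ c^n_L` (modulo the identification `1 × m = m`). -/
def Uniform : Prop :=
  ∀ (n m : Type) (f : L.Hom n m), ∃ (k : Type) (fhat : L.Hom k PUnit)
    (u : k × m → n ⊕ L.consts),
    f = L.comp (L.ofFun (fun j : m => (PUnit.unit, j)))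
        (L.comp (L.tensorR fhat m) (L.comp (L.ofFun u) (L.constTuple n)))

/-- `L` is bounded if `|L(0,1)| = 1`. -/
def Bounded : Prop :=
  ∃ c : L.Hom PEmpty PUnit, ∀ d : L.Hom PEmpty PUnit, d = c

end LawvereTheory

/-- A morphism of large Lawvere theories: a functor commuting with the indexing functors
(hence identity on objects and preserving small products). -/
structure LawvereHom (L₁ L₂ : LawvereTheory) where
  map : {n m : Type} → L₁.Hom n m → L₂.Hom n m
  map_comp : ∀ {n m k : Type} (f : L₁.Hom m k) (g : L₁.Hom n m),
    map (L₁.comp f g) = L₂.comp (map f) (map g)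
  map_ofFun : ∀ {n m : Type} (e : m → n), map (L₁.ofFun e) = L₂.ofFun e

namespace LawvereHom

/-- a theory morphism is an isomorphism if it has a two-sided inverse theory morphism. -/
def IsIso {L₁ L₂ : LawvereTheory} (α : LawvereHom L₁ L₂) : Prop :=
  ∃ β : LawvereHom L₂ L₁,
    (∀ (n m : Type) (f : L₁.Hom n m), β.map (α.map f) = f) ∧
    (∀ (n m : Type) (g : L₂.Hom n m), α.map (β.map g) = g)

/-- faithfulness of a theory morphism. -/
def Faithful {L₁ L₂ : LawvereTheory} (α : LawvereHom L₁ L₂) : Prop :=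
  ∀ (n m : Type) (f g : L₁.Hom n m), α.map f = α.map g → f = g

end LawvereHom

/-- The tensor law for a cospan `L₁ → T ← L₂`:
`(σ₁f₁ ⊗ m₂) ∘ (n₁ ⊗ σ₂f₂) = (m₁ ⊗ σ₂f₂) ∘ (σ₁f₁ ⊗ n₂)`. -/
def TensorLaw {L₁ L₂ T : LawvereTheory} (σ₁ : LawvereHom L₁ T) (σ₂ : LawvereHom L₂ T) : Prop :=
  ∀ (n₁ m₁ n₂ m₂ : Type) (f₁ : L₁.Hom n₁ m₁) (f₂ : L₂.Hom n₂ m₂),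
    T.comp (T.tensorR (σ₁.map f₁) m₂) (T.tensorL n₁ (σ₂.map f₂))
      = T.comp (T.tensorL m₁ (σ₂.map f₂)) (T.tensorR (σ₁.map f₁) n₂)

/-- A candidate for the tensor product: a theory with a commuting cospan from `L₁`, `L₂`. -/
structure TensorCandidate (L₁ L₂ : LawvereTheory) where
  T : LawvereTheory
  σ₁ : LawvereHom L₁ T
  σ₂ : LawvereHom L₂ T
  law : TensorLaw σ₁ σ₂

/-- A tensor candidate is the tensor product `L₁ ⊗ L₂` if it is universal among all
candidates. -/
def IsLawvereTensor {L₁ L₂ : LawvereTheory} (C : TensorCandidate L₁ L₂) : Prop :=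
  ∀ D : TensorCandidate L₁ L₂, ∃! α : LawvereHom C.T D.T,
    (∀ (n m : Type) (f : L₁.Hom n m), α.map (C.σ₁.map f) = D.σ₁.map f) ∧
    (∀ (n m : Type) (g : L₂.Hom n m), α.map (C.σ₂.map g) = D.σ₂.map g)

/-! ### Bottom morphisms, approximation, rectangular equivalence, closed sets -/

namespace LawvereTheory

variable (L : LawvereTheory)

/-- `⊥_{n,m} : n → m`, built from a chosen constant `c = ⊥_{0,1}`:
`⊥_{n,m} = (⊥_{0,1} ⊗ m) ∘ [♯]` (modulo `1 × m = m`, `0 × m = 0`). -/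
def botMor (c : L.Hom PEmpty PUnit) (n m : Type) : L.Hom n m :=
  L.comp (L.ofFun (fun j : m => (PUnit.unit, j)))
    (L.comp (L.tensorR c m) (L.ofFun (fun x : PEmpty × m => x.1.elim)))

/-- The approximation preorder `⊑` on the hom-sets of a bounded theory with constant `c`:
the smallest family of preorders with `⊥_{n,m}` as bottom element and closed under the
rule `(π_⊑)` (monotonicity of tupling and composition). -/
inductive Approx (c : L.Hom PEmpty PUnit) : {n m : Type} → L.Hom n m → L.Hom n m → Prop
  | refl {n m : Type} (f : L.Hom n m) : Approx c f f
  | trans {n m : Type} {f g h : L.Hom n m} :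
      Approx c f g → Approx c g h → Approx c f h
  | bot {n m : Type} (f : L.Hom n m) : Approx c (L.botMor c n m) f
  | step {n m k : Type} {f g : L.Hom n m} (h : L.Hom m k) :
      (∀ i : m, Approx c (L.comp (L.proj i) f) (L.comp (L.proj i) g)) →
      Approx c (L.comp h f) (L.comp h g)

section Classical
open Classical in
/-- `δ_{ij} : 1 → 1`: the identity if `i = j`, and `⊥_{1,1}` otherwise. -/
noncomputable def delta (c : L.Hom PEmpty PUnit) {m : Type} (i j : m) : L.Hom PUnit PUnit :=
  if i = j then L.id PUnit else L.botMor c PUnit PUnit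
end Classical

/-- `Δ_i = ∏_j δ_{ij} : m → m`. -/
noncomputable def Delta (c : L.Hom PEmpty PUnit) {m : Type} (i : m) : L.Hom m m :=
  L.comp (L.ofFun (fun j : m => (⟨j, PUnit.unit⟩ : Σ _ : m, PUnit)))
    (L.tuple (fun j : m => L.comp (L.delta c i j) (L.proj j)))

/-- composition of sets of morphisms, `A B = {a ∘ b | a ∈ A, b ∈ B}`. -/
def setComp {n m k : Type} (C : Set (L.Hom m k)) (A : Set (L.Hom n m)) : Set (L.Hom n k) :=
  {h | ∃ f ∈ C, ∃ g ∈ A, h = L.comp f g}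

/-- Rectangular equivalence `≈` on sets of `L`-morphisms: the smallest equivalence
containing `(⊥): {⊥_{n,m}} ≈ ∅` and closed under the rule `(π)`:
if `[κ_i] A ≈ [κ_i] B` for all `i`, then `C A ≈ C B`. -/
inductive RectEq (c : L.Hom PEmpty PUnit) :
    {n m : Type} → Set (L.Hom n m) → Set (L.Hom n m) → Prop
  | refl {n m : Type} (A : Set (L.Hom n m)) : RectEq c A A
  | symm {n m : Type} {A B : Set (L.Hom n m)} : RectEq c A B → RectEq c B A
  | trans {n m : Type} {A B C : Set (L.Hom n m)} :
      RectEq c A B → RectEq c B C → RectEq c A C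
  | bot {n m : Type} : RectEq c {L.botMor c n m} (∅ : Set (L.Hom n m))
  | pi {n m k : Type} {A B : Set (L.Hom n m)} (C : Set (L.Hom m k)) :
      (∀ i : m, RectEq c (L.setComp {L.proj i} A) (L.setComp {L.proj i} B)) →
      RectEq c (L.setComp C A) (L.setComp C B)

/-- rectangular equivalence as a setoid. -/
def rectSetoid (c : L.Hom PEmpty PUnit) (n m : Type) : Setoid (Set (L.Hom n m)) :=
  ⟨RectEq L c, ⟨fun A => RectEq.refl A, RectEq.symm, RectEq.trans⟩⟩

/-- membership in the closure of a set of morphisms: the smallest set containing `A`,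
downward closed under `⊑`, and closed under the rule `(Δ)`. -/
inductive InCl (c : L.Hom PEmpty PUnit) :
    {n k : Type} → Set (L.Hom n k) → L.Hom n k → Prop
  | base {n k : Type} {A : Set (L.Hom n k)} {f : L.Hom n k} : f ∈ A → InCl c A f
  | down {n k : Type} {A : Set (L.Hom n k)} {f g : L.Hom n k} :
      InCl c A g → L.Approx c f g → InCl c A f
  | delta {n k : Type} {A : Set (L.Hom n k)} {m : Type} (g : L.Hom n m) (f : L.Hom m k) :
      (∀ i : m, InCl c A (L.comp (L.comp f (L.Delta c i)) g)) →
      InCl c A (L.comp f g)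

/-- `cl A`: the smallest closed set containing `A`. -/
def cl (c : L.Hom PEmpty PUnit) {n k : Type} (A : Set (L.Hom n k)) : Set (L.Hom n k) :=
  {f | L.InCl c A f}

/-- `IsLUBApprox S h`: `h` is a least upper bound of `S` w.r.t. the approximation
preorder `⊑`. -/
def IsLUBApprox (c : L.Hom PEmpty PUnit) {n k : Type} (S : Set (L.Hom n k))
    (h : L.Hom n k) : Prop :=
  (∀ f ∈ S, L.Approx c f h) ∧ ∀ h', (∀ f ∈ S, L.Approx c f h') → L.Approx c h h'

/-- `L` is finitary (has rank `ω`) if every morphism into `1` factors through a finite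
power of `1`. -/
def Finitary : Prop :=
  ∀ (n : Type) (f : L.Hom n PUnit), ∃ (k : Type) (_ : Finite k) (e : k → n)
    (g : L.Hom k PUnit), f = L.comp g (L.ofFun e)

end LawvereTheory

namespace LawvereTheory

variable (L : LawvereTheory)

/-- Morphisms into a power of `1` are determined by their components. -/
theorem hom_ext_proj {n m : Type} {f g : L.Hom n m}
    (h : ∀ i : m, L.comp (L.proj i) f = L.comp (L.proj i) g) : f = g := by
  have key : L.comp (L.ofFun (fun x : (Σ _ : m, PUnit) => x.1)) f =
      L.comp (L.ofFun (fun x : (Σ _ : m, PUnit) => x.1)) g := by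
    refine L.tuple_ext _ _ fun i => ?_
    rw [← L.comp_assoc, ← L.comp_assoc, ← L.ofFun_comp]
    exact h i
  have retract (f : L.Hom n m) :
      L.comp (L.ofFun (fun i : m => (⟨i, PUnit.unit⟩ : Σ _ : m, PUnit)))
        (L.comp (L.ofFun (fun x : (Σ _ : m, PUnit) => x.1)) f) = f := by
    rw [← L.comp_assoc, ← L.ofFun_comp, L.ofFun_id, L.id_comp]
  rw [← retract f, key, retract]

/-- Every component of `⊥_{n,m}` is the constant `⊥_{0,1}`. -/
theorem proj_comp_botMor (c : L.Hom PEmpty PUnit) {n m : Type} (j : m) :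
    L.comp (L.proj j) (L.botMor c n m) = L.toConst c := by
  have hj : L.comp (L.proj j) (L.comp (L.ofFun (fun j : m => (PUnit.unit, j)))
      (L.tensorR c m)) = L.comp c (L.ofFun (fun x : PEmpty => (x, j))) := by
    unfold proj tensorR tupleR
    rw [← L.comp_assoc, ← L.comp_assoc, ← L.ofFun_comp, ← L.ofFun_comp]
    exact L.tuple_proj (fun j : m => L.comp c (L.ofFun (fun x : PEmpty => (x, j)))) j
  unfold botMor toConst
  rw [← L.comp_assoc (L.ofFun _), ← L.comp_assoc, hj, L.comp_assoc, ← L.ofFun_comp]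

end LawvereTheory

namespace LawvereHom

variable {L L' : LawvereTheory} (F : LawvereHom L L')

theorem map_proj {m : Type} (i : m) : F.map (L.proj i) = L'.proj i :=
  F.map_ofFun _

theorem map_toConst {n : Type} (c : L.Hom PEmpty PUnit) :
    F.map (L.toConst (n := n) c) = L'.toConst (F.map c) := by
  unfold LawvereTheory.toConst
  rw [F.map_comp, F.map_ofFun]

theorem map_botMor (c : L.Hom PEmpty PUnit) {c' : L'.Hom PEmpty PUnit} (hc : F.map c = c')
    {n m : Type} : F.map (L.botMor c n m) = L'.botMor c' n m := by
  refine L'.hom_ext_proj fun i => ?_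
  rw [← F.map_proj, ← F.map_comp, L.proj_comp_botMor, F.map_toConst, hc, F.map_proj,
    L'.proj_comp_botMor]

end LawvereHom

/-- **Statement 10.** Every morphism of large Lawvere theories between bounded large
Lawvere theories preserves the approximation preorder. -/
theorem lawvereHom_preserves_approx (L L' : LawvereTheory)
    (c : L.Hom PEmpty PUnit) (hc : ∀ d : L.Hom PEmpty PUnit, d = c)
    (c' : L'.Hom PEmpty PUnit) (hc' : ∀ d : L'.Hom PEmpty PUnit, d = c')
    (F : LawvereHom L L') (n m : Type) (f g : L.Hom n m)
    (h : L.Approx c f g) :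
    L'.Approx c' (F.map f) (F.map g) := by
  induction h with
  | refl f => exact .refl _
  | trans _ _ ih₁ ih₂ => exact .trans ih₁ ih₂
  | bot f =>
    rw [F.map_botMor c (hc' _)]
    exact .bot _
  | step h _ ih =>
    simp only [F.map_comp, F.map_proj] at ih ⊢
    exact .step _ ih
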